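/- Let h ∈ ℝ[x₁,…,x_m] be hyperbolic with respect to e ∈ Γ₊₊ and let α > 0. Then for any vectors M, v in the closed hyperbolicity cone Γ₊ (with D_v h not identically zero), (D_v h)(αe + M) / h(αe + M) ≤ (D_v h)(αe) / h(αe). -/

import Mathlib

open MvPolynomial Finset
open scoped Classical

noncomputable section

/-- `h` is homogeneous of degree `d`, positive at `e`, and for every `x` the univariate
polynomial `t ↦ h (t • e - x)` factors with real roots `lam x 1 ≥ … ≥ lam x d`
(the hyperbolic eigenvalues of `x`). -/
def IsHyperbolic {m d : ℕ} (h : MvPolynomial (Fin m) ℝ) (e : Fin m → ℝ)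
    (lam : (Fin m → ℝ) → Fin d → ℝ) : Prop :=
  h.IsHomogeneous d ∧ 0 < eval e h ∧ (∀ x, Antitone (lam x)) ∧
    ∀ x : Fin m → ℝ, ∀ t : ℝ,
      eval (t • e - x) h = eval e h * ∏ i, (t - lam x i)

/-- hyperbolic trace: the sum of the hyperbolic eigenvalues. -/
def htrace {m d : ℕ} (lam : (Fin m → ℝ) → Fin d → ℝ) (x : Fin m → ℝ) : ℝ :=
  ∑ i, lam x i

/-- hyperbolic rank: the number of nonzero hyperbolic eigenvalues. -/
def hrank {m d : ℕ} (lam : (Fin m → ℝ) → Fin d → ℝ) (x : Fin m → ℝ) : ℕ :=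
  Nat.card {i : Fin d // lam x i ≠ 0}

/-- hyperbolic norm: the largest absolute value of a hyperbolic eigenvalue. -/
def hnorm {m d : ℕ} (lam : (Fin m → ℝ) → Fin d → ℝ) (x : Fin m → ℝ) : ℝ :=
  ⨆ i, |lam x i|

/-- closed hyperbolicity cone: all hyperbolic eigenvalues nonnegative. -/
def InCone {m d : ℕ} (lam : (Fin m → ℝ) → Fin d → ℝ) (x : Fin m → ℝ) : Prop :=
  ∀ i, 0 ≤ lam x i

/-- open hyperbolicity cone: all hyperbolic eigenvalues positive. -/
def InOpenCone {m d : ℕ} (lam : (Fin m → ℝ) → Fin d → ℝ) (x : Fin m → ℝ) : Prop :=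
  ∀ i, 0 < lam x i

/-- directional derivative `D_v h = ∑ i, v i • ∂h/∂x i`. -/
def Dv {m : ℕ} (h : MvPolynomial (Fin m) ℝ) (v : Fin m → ℝ) : MvPolynomial (Fin m) ℝ :=
  ∑ i, C (v i) * pderiv i h

/-- The restriction `t ↦ f (a + t • b)` of `f` to a line, as a univariate polynomial. -/
def linePoly {m : ℕ} {K : Type*} [Field K] [Algebra ℝ K] (f : MvPolynomial (Fin m) ℝ)
    (a b : Fin m → K) : Polynomial K :=
  aeval (fun i => Polynomial.C (a i) + Polynomial.X * Polynomial.C (b i)) f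

section LinePoly

lemma natDegree_prod_linear_pow_le {m : ℕ} {K : Type*} [Field K] (a b : Fin m → K) (s : Fin m → ℕ) (T : Finset (Fin m)) :
    (∏ i ∈ T, (Polynomial.C (a i) + Polynomial.X * Polynomial.C (b i)) ^ s i).natDegree
        ≤ ∑ i ∈ T, s i ∧
      (∏ i ∈ T, (Polynomial.C (a i) + Polynomial.X * Polynomial.C (b i)) ^ s i).coeff
        (∑ i ∈ T, s i) = ∏ i ∈ T, b i ^ s i := by
  induction T using Finset.induction_on with
  | empty => simp
  | insert j T hj ih =>
    have h1 : (Polynomial.C (a j) + Polynomial.X * Polynomial.C (b j)).natDegree ≤ 1 := by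
      compute_degree
    have h2 : ((Polynomial.C (a j) + Polynomial.X * Polynomial.C (b j)) ^ s j).natDegree
        ≤ s j := by
      simpa using Polynomial.natDegree_pow_le_of_le (s j) h1
    rw [Finset.prod_insert hj, Finset.sum_insert hj, Finset.prod_insert hj]
    refine ⟨Polynomial.natDegree_mul_le_of_le h2 ih.1, ?_⟩
    rw [Polynomial.coeff_mul_add_eq_of_natDegree_le h2 ih.1, ih.2]
    congr 1
    have := Polynomial.coeff_pow_of_natDegree_le (m := s j) h1
    simpa [Polynomial.coeff_C] using this

variable {m : ℕ} {K : Type*} [Field K] [Algebra ℝ K]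

lemma eval_linePoly (f : MvPolynomial (Fin m) ℝ) (a b : Fin m → K) (t : K) :
    (linePoly f a b).eval t = aeval (a + t • b) f := by
  induction f using MvPolynomial.induction_on with
  | C r => simp [linePoly, Polynomial.algebraMap_apply]
  | add p q hp hq => simp_all [linePoly]
  | mul_X p i hp =>
    simp_all [linePoly]
    simp [mul_comm]

lemma linePoly_Dv (f : MvPolynomial (Fin m) ℝ) (a : Fin m → K) (v : Fin m → ℝ) :
    (linePoly f a (fun i => algebraMap ℝ K (v i))).derivative
      = linePoly (Dv f v) a (fun i => algebraMap ℝ K (v i)) := by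
  induction f using MvPolynomial.induction_on with
  | C r => simp [linePoly, Dv, Polynomial.algebraMap_apply]
  | add p q hp hq =>
    simp_all [linePoly, Dv, mul_add, Finset.sum_add_distrib]
  | mul_X p i hp =>
    have h1 : Dv (p * X i) v = Dv p v * X i + p * C (v i) := by
      simp only [Dv, Derivation.leibniz, pderiv_X, smul_eq_mul, mul_add, Finset.sum_add_distrib]
      rw [add_comm, Finset.sum_mul]
      congr 1
      · exact Finset.sum_congr rfl fun j _ => by ring
      · rw [Finset.sum_eq_single i]
        · simp [mul_comm]
        · intro j _ hj
          simp [hj]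
        · simp
    rw [h1]
    simp only [linePoly, map_mul, map_add, aeval_X, Polynomial.derivative_mul, aeval_C] at hp ⊢
    rw [hp]
    simp [Polynomial.algebraMap_apply]

lemma aeval_eq_sum_prod (f : MvPolynomial (Fin m) ℝ) {A : Type*} [CommRing A] [Algebra ℝ A]
    (x : Fin m → A) :
    aeval x f = ∑ s ∈ f.support, algebraMap ℝ A (f.coeff s) * ∏ i, x i ^ s i := by
  rw [aeval_def, eval₂_eq']

lemma sum_eq_of_isHomogeneous {f : MvPolynomial (Fin m) ℝ} {d : ℕ} (hf : f.IsHomogeneous d)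
    {s : Fin m →₀ ℕ} (hs : s ∈ f.support) : ∑ i, s i = d := by
  have := hf (mem_support_iff.mp hs)
  rw [← this, Finsupp.weight_apply, Finsupp.sum_fintype] <;> simp

lemma aeval_smul_of_isHomogeneous {f : MvPolynomial (Fin m) ℝ} {d : ℕ}
    (hf : f.IsHomogeneous d) (c : K) (x : Fin m → K) :
    aeval (c • x) f = c ^ d * aeval x f := by
  rw [aeval_eq_sum_prod, aeval_eq_sum_prod, Finset.mul_sum]
  refine Finset.sum_congr rfl fun s hs => ?_
  simp only [Pi.smul_apply, smul_eq_mul, mul_pow, Finset.prod_mul_distrib,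
    Finset.prod_pow_eq_pow_sum, sum_eq_of_isHomogeneous hf hs]
  ring

lemma natDegree_linePoly_le {f : MvPolynomial (Fin m) ℝ} {d : ℕ}
    (hf : f.IsHomogeneous d) (a b : Fin m → K) : (linePoly f a b).natDegree ≤ d := by
  rw [linePoly, aeval_eq_sum_prod]
  refine Polynomial.natDegree_sum_le_of_forall_le _ _ fun s hs => ?_
  rw [Polynomial.algebraMap_apply]
  refine (Polynomial.natDegree_C_mul_le _ _).trans ?_
  rw [← sum_eq_of_isHomogeneous hf hs]
  exact (natDegree_prod_linear_pow_le a b s Finset.univ).1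

lemma coeff_linePoly {f : MvPolynomial (Fin m) ℝ} {d : ℕ}
    (hf : f.IsHomogeneous d) (a b : Fin m → K) : (linePoly f a b).coeff d = aeval b f := by
  rw [linePoly, aeval_eq_sum_prod, aeval_eq_sum_prod, Polynomial.finsetSum_coeff]
  refine Finset.sum_congr rfl fun s hs => ?_
  rw [Polynomial.algebraMap_apply, Polynomial.coeff_C_mul, ← sum_eq_of_isHomogeneous hf hs,
    (natDegree_prod_linear_pow_le a b s Finset.univ).2]

end LinePoly

/-- A real vector regarded as a complex vector. -/
def complexify {m : ℕ} (x : Fin m → ℝ) : Fin m → ℂ := fun i => (x i : ℂ)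

section Deformation

variable {m d : ℕ} {h : MvPolynomial (Fin m) ℝ}

lemma complexify_add (x y : Fin m → ℝ) :
    complexify (x + y) = complexify x + complexify y := by
  ext i; simp [complexify]

lemma complexify_smul (c : ℝ) (x : Fin m → ℝ) :
    complexify (c • x) = (c : ℂ) • complexify x := by
  ext i; simp [complexify]

lemma map_linePoly (f : MvPolynomial (Fin m) ℝ) (a b : Fin m → ℝ) :
    (linePoly f a b).map (algebraMap ℝ ℂ) = linePoly f (complexify a) (complexify b) := by
  induction f using MvPolynomial.induction_on with
  | C r => simp [linePoly, Polynomial.algebraMap_apply]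
  | add p q hp hq => simp_all [linePoly]
  | mul_X p i hp => simp_all [linePoly, complexify]

lemma aeval_complexify (f : MvPolynomial (Fin m) ℝ) (x : Fin m → ℝ) :
    aeval (complexify x) f = ((eval x f : ℝ) : ℂ) :=
  aeval_algebraMap_apply ℂ x f

lemma continuous_aeval_complex (f : MvPolynomial (Fin m) ℝ) :
    Continuous fun x : Fin m → ℂ => aeval x f := by
  simp only [aeval_eq_sum_prod]
  fun_prop

lemma norm_leadingCoeff_mul_pow_le (p : Polynomial ℂ) (w : ℂ) (hw : 0 ≤ w.im)
    (hp : ∀ r ∈ p.roots, r.im ≤ 0) :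
    ‖p.leadingCoeff‖ * w.im ^ p.natDegree ≤ ‖p.eval w‖ := by
  have hs := IsAlgClosed.splits p
  rw [hs.eval_eq_prod_roots, norm_mul, hs.natDegree_eq_card_roots]
  gcongr
  generalize p.roots = R at hp
  induction R using Multiset.induction_on with
  | empty => simp
  | cons r R ih =>
    have h1 : w.im ≤ ‖w - r‖ := by
      refine le_trans ?_ (Complex.abs_im_le_norm (w - r))
      have := hp r (by simp)
      rw [Complex.sub_im]
      exact le_trans (by linarith) (le_abs_self _)
    have h2 := ih fun r' hr' => hp r' (by simp [hr'])
    simp only [Multiset.card_cons, pow_succ, Multiset.map_cons, Multiset.prod_cons, norm_mul]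
    rw [mul_comm]
    gcongr

/-- Roots of a family of polynomials of constant degree that never meet the real axis stay in the
lower half-plane. -/
lemma aeval_ne_zero_of_path (hh : h.IsHomogeneous d) {A : unitInterval → Fin m → ℂ}
    (hA : Continuous A) {V : Fin m → ℂ} (hV : aeval V h ≠ 0)
    (hreal : ∀ τ, ∀ w : ℝ, aeval (A τ + (w : ℂ) • V) h ≠ 0)
    (h0 : ∀ w : ℂ, 0 ≤ w.im → aeval (A 0 + w • V) h ≠ 0) (w : ℂ) (hw : 0 ≤ w.im) :
    aeval (A 1 + w • V) h ≠ 0 := by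
  set S : Set unitInterval := {τ | ∃ w : ℂ, 0 ≤ w.im ∧ aeval (A τ + w • V) h = 0} with hS
  have hcont := continuous_aeval_complex h
  have hclosed : IsClosed S := by
    let T : Set (unitInterval × (ℝ × ℂ)) :=
      {p | (0 ≤ p.2.1 ∧ 0 ≤ p.2.2.im) ∧ aeval ((p.2.1 : ℂ) • A p.1 + p.2.2 • V) h = 0}
    have hT : IsClosed T := by
      have h1 : Continuous fun p : unitInterval × (ℝ × ℂ) => p.2.1 := by fun_prop
      have h2 : Continuous fun p : unitInterval × (ℝ × ℂ) => p.2.2.im := by fun_prop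
      refine ((isClosed_le continuous_const h1).inter (isClosed_le continuous_const h2)).inter
        (isClosed_eq (hcont.comp ?_) continuous_const)
      fun_prop
    have hc : IsCompact (T ∩ (Set.univ ×ˢ Metric.sphere (0 : ℝ × ℂ) 1)) :=
      (isCompact_univ.prod (isCompact_sphere _ _)).inter_left hT
    convert (hc.image continuous_fst).isClosed using 1
    ext τ
    constructor
    · rintro ⟨w, hw, hz⟩
      set n : ℝ := ‖((1 : ℝ), w)‖ with hn
      have hn0 : 0 < n := by
        rw [hn, norm_pos_iff]
        simp
      refine ⟨(τ, n⁻¹ • ((1 : ℝ), w)), ⟨⟨⟨?_, ?_⟩, ?_⟩, trivial, ?_⟩, rfl⟩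
      · simpa using hn0.le
      · simpa using mul_nonneg (inv_nonneg.mpr hn0.le) hw
      · have : ((n⁻¹ • ((1 : ℝ), w)).1 : ℂ) • A τ + (n⁻¹ • ((1 : ℝ), w)).2 • V
            = ((n⁻¹ : ℝ) : ℂ) • (A τ + w • V) := by
          ext i
          simp
          ring
        change aeval (((n⁻¹ • ((1 : ℝ), w)).1 : ℂ) • A τ + (n⁻¹ • ((1 : ℝ), w)).2 • V) h = 0
        rw [this, aeval_smul_of_isHomogeneous hh, hz, mul_zero]
      · rw [mem_sphere_zero_iff_norm, norm_smul, ← hn, norm_inv, Real.norm_of_nonneg hn0.le,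
          inv_mul_cancel₀ hn0.ne']
    · rintro ⟨⟨τ', r, w⟩, ⟨⟨⟨hr, hw⟩, hz⟩, -, hs⟩, rfl⟩
      simp only at hr hw hz
      rcases hr.eq_or_lt with rfl | hr
      · exfalso
        have hw0 : w ≠ 0 := by
          rintro rfl
          simp at hs
        rw [Complex.ofReal_zero, zero_smul, zero_add, aeval_smul_of_isHomogeneous hh] at hz
        exact mul_ne_zero (pow_ne_zero _ hw0) hV hz
      · refine ⟨((r⁻¹ : ℝ) : ℂ) * w, ?_, ?_⟩
        · rw [Complex.im_ofReal_mul]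
          positivity
        · have hrc : (r : ℂ) ≠ 0 := by exact_mod_cast hr.ne'
          have : A τ' + (((r⁻¹ : ℝ) : ℂ) * w) • V
              = ((r⁻¹ : ℝ) : ℂ) • ((r : ℂ) • A τ' + w • V) := by
            rw [smul_add, smul_smul, smul_smul, ← Complex.ofReal_mul, inv_mul_cancel₀ hr.ne',
              Complex.ofReal_one, one_smul]
          change aeval (A τ' + _) h = 0
          rw [this, aeval_smul_of_isHomogeneous hh, hz, mul_zero]
  have hopen : IsOpen S := by
    rw [isOpen_iff_mem_nhds]
    rintro τ₀ ⟨w₀, hw₀, hz₀⟩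
    have him : 0 < w₀.im := by
      refine hw₀.lt_of_ne fun him => hreal τ₀ w₀.re ?_
      rwa [show ((w₀.re : ℝ) : ℂ) = w₀ from Complex.ext (by simp) (by simp [← him])]
    have hg : Continuous fun τ => ‖aeval (A τ + w₀ • V) h‖ :=
      (hcont.comp (hA.add continuous_const)).norm
    have hlt : ‖aeval (A τ₀ + w₀ • V) h‖ < ‖aeval V h‖ * w₀.im ^ d := by
      rw [hz₀, norm_zero]
      exact mul_pos (norm_pos_iff.mpr hV) (pow_pos him d)
    filter_upwards [hg.continuousAt.eventually_lt continuousAt_const hlt] with τ hτ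
    by_contra hcon
    have hcoeff := coeff_linePoly hh (A τ) V
    have hdeg : (linePoly h (A τ) V).natDegree = d :=
      le_antisymm (natDegree_linePoly_le hh _ _)
        (Polynomial.le_natDegree_of_ne_zero (by rwa [hcoeff]))
    have := norm_leadingCoeff_mul_pow_le (linePoly h (A τ) V) w₀ hw₀ fun r hr => by
      by_contra! hr'
      refine hcon ⟨r, hr'.le, ?_⟩
      rw [← eval_linePoly]
      exact (Polynomial.mem_roots'.mp hr).2
    rw [Polynomial.leadingCoeff, hdeg, hcoeff, eval_linePoly] at this
    exact absurd hτ (not_lt.mpr this)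
  rcases isClopen_iff.mp ⟨hclosed, hopen⟩ with hE | hU
  · exact fun hz => (hE ▸ (⟨w, hw, hz⟩ : (1 : unitInterval) ∈ S) : (1 : unitInterval) ∈ (∅ : Set _))
  · obtain ⟨w', hw', hz'⟩ : (0 : unitInterval) ∈ S := hU ▸ Set.mem_univ _
    exact absurd hz' (h0 w' hw')

end Deformation

section Hyperbolic

variable {m d : ℕ} {h : MvPolynomial (Fin m) ℝ} {e : Fin m → ℝ}
  {lam : (Fin m → ℝ) → Fin d → ℝ}

lemma IsHyperbolic.aeval_smul_add (hhyp : IsHyperbolic h e lam) (ζ : ℂ) (x : Fin m → ℝ) :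
    aeval (ζ • complexify e + complexify x) h
      = (eval e h : ℂ) * ∏ i, (ζ + (lam x i : ℂ)) := by
  obtain ⟨hh, -, -, hfac⟩ := hhyp
  have key : linePoly h x e
      = Polynomial.C (eval e h) * ∏ i, (Polynomial.X + Polynomial.C (lam x i)) := by
    refine Polynomial.funext fun t => ?_
    have h1 : x + t • e = (-1 : ℝ) • ((-t) • e - x) := by
      ext i
      simp
    rw [eval_linePoly, h1, aeval_smul_of_isHomogeneous hh]
    change (-1) ^ d * eval _ h = _
    rw [hfac, Polynomial.eval_mul, Polynomial.eval_prod, Polynomial.eval_C, mul_left_comm]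
    congr 1
    have h2 : ((-1 : ℝ)) ^ d = ∏ _i : Fin d, (-1 : ℝ) := by simp
    rw [h2, ← Finset.prod_mul_distrib]
    refine Finset.prod_congr rfl fun i _ => ?_
    simp
    ring
  rw [add_comm, ← eval_linePoly, ← map_linePoly, key]
  simp [Polynomial.eval_prod, Polynomial.map_prod]

lemma IsHyperbolic.aeval_add_smul_ne_zero (hhyp : IsHyperbolic h e lam) {v : Fin m → ℝ}
    (hv : InCone lam v) {δ : ℝ} (hδ : 0 < δ) : aeval (complexify (v + δ • e)) h ≠ 0 := by
  rw [complexify_add, complexify_smul, add_comm, hhyp.aeval_smul_add]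
  refine mul_ne_zero (by exact_mod_cast hhyp.2.1.ne') (Finset.prod_ne_zero_iff.mpr fun i _ => ?_)
  have := hv i
  exact_mod_cast (by positivity : 0 < δ + lam v i).ne'

lemma IsHyperbolic.aeval_imaginary_add_smul_ne_zero (hhyp : IsHyperbolic h e lam)
    {v : Fin m → ℝ} (hv : InCone lam v) {δ : ℝ} (hδ : 0 < δ) {η : ℝ} (hη : 0 < η) (w : ℂ)
    (hw : 0 ≤ w.im) :
    aeval ((Complex.I * η) • complexify e + w • complexify (v + δ • e)) h ≠ 0 := by
  have he : (eval e h : ℂ) ≠ 0 := by exact_mod_cast hhyp.2.1.ne'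
  have hIη : Complex.I * η ≠ 0 := mul_ne_zero Complex.I_ne_zero (by exact_mod_cast hη.ne')
  rcases eq_or_ne w 0 with rfl | hw0
  · rw [zero_smul, add_zero, aeval_smul_of_isHomogeneous hhyp.1, aeval_complexify]
    exact mul_ne_zero (pow_ne_zero _ hIη) he
  · have h1 : (Complex.I * η) • complexify e + w • complexify (v + δ • e)
        = w • ((Complex.I * η / w + δ) • complexify e + complexify v) := by
      ext i
      simp [complexify]
      field_simp
      ring
    rw [h1, aeval_smul_of_isHomogeneous hhyp.1, hhyp.aeval_smul_add]
    refine mul_ne_zero (pow_ne_zero _ hw0) (mul_ne_zero he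
      (Finset.prod_ne_zero_iff.mpr fun i _ hi => ?_))
    have h2 : Complex.I * η + ((δ + lam v i : ℝ) : ℂ) * w = 0 := by
      field_simp at hi
      push_cast
      linear_combination hi
    have h3 := congrArg Complex.im h2
    simp only [Complex.add_im, Complex.mul_im, Complex.I_re, Complex.I_im,
      Complex.ofReal_re, Complex.ofReal_im, Complex.zero_im] at h3
    have := hv i
    have : 0 ≤ (δ + lam v i) * w.im := by positivity
    linarith

/-- If `h` does not vanish at points with imaginary part `η • e + τ • y`, `τ ∈ [0, 1]`, then adding
a cone direction with a coefficient in the closed upper half-plane keeps it nonzero. -/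
lemma IsHyperbolic.aeval_ne_zero_of_imaginary_part (hhyp : IsHyperbolic h e lam)
    {v : Fin m → ℝ} (hv : InCone lam v) {δ : ℝ} (hδ : 0 < δ) {η : ℝ} (hη : 0 < η)
    {y : Fin m → ℝ}
    (hy : ∀ τ : ℝ, 0 ≤ τ → ∀ x : Fin m → ℝ,
      aeval (complexify x + Complex.I • complexify (η • e + τ • y)) h ≠ 0)
    (x : Fin m → ℝ) (w : ℂ) (hw : 0 ≤ w.im) :
    aeval (complexify x + Complex.I • complexify (η • e + y)
      + w • complexify (v + δ • e)) h ≠ 0 := by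
  let A : unitInterval → Fin m → ℂ := fun τ =>
    ((τ : ℝ) : ℂ) • (complexify x + Complex.I • complexify y) + (Complex.I * η) • complexify e
  have hA : Continuous A := by fun_prop
  have hA1 : complexify x + Complex.I • complexify (η • e + y) = A 1 := by
    ext i
    simp [A, complexify]
    ring
  rw [hA1]
  refine aeval_ne_zero_of_path hhyp.1 hA (hhyp.aeval_add_smul_ne_zero hv hδ) (fun τ w => ?_)
    (fun w hw => ?_) w hw
  · convert hy τ τ.2.1 ((τ : ℝ) • x + w • (v + δ • e)) using 2
    congr 1
    ext i
    simp [A, complexify]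
    ring
  · have := hhyp.aeval_imaginary_add_smul_ne_zero hv hδ hη w hw
    simpa [A] using this

lemma IsHyperbolic.aeval_ne_zero_of_imaginary_part_mem_cone (hhyp : IsHyperbolic h e lam)
    {M : Fin m → ℝ} (hM : InCone lam M) {η : ℝ} (hη : 0 < η) {ε : ℝ} (hε : 0 ≤ ε)
    (x : Fin m → ℝ) :
    aeval (complexify x + Complex.I • complexify (η • e + ε • M)) h ≠ 0 := by
  set δ : ℝ := η / (ε + 1) with hδ
  have hδ0 : 0 < δ := by positivity
  have hη' : 0 < η - ε * δ := by
    have : η = δ * (ε + 1) := by rw [hδ]; field_simp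
    nlinarith
  have := hhyp.aeval_ne_zero_of_imaginary_part (y := 0) hM hδ0 hη' (fun τ _ x => ?_) x
    (Complex.I * ε) (by simpa using hε)
  · convert this using 2
    congr 1
    ext i
    simp [complexify]
    ring
  · have h1 : complexify x + Complex.I • complexify ((η - ε * δ) • e + τ • 0)
        = (Complex.I * ((η - ε * δ : ℝ) : ℂ)) • complexify e + complexify x := by
      ext i
      simp [complexify]
      ring
    rw [h1, hhyp.aeval_smul_add]
    refine mul_ne_zero (by exact_mod_cast hhyp.2.1.ne')
      (Finset.prod_ne_zero_iff.mpr fun i _ hi => ?_)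
    have h3 := congrArg Complex.im hi
    simp only [Complex.add_im, Complex.mul_im, Complex.I_re, Complex.I_im,
      Complex.ofReal_re, Complex.ofReal_im, Complex.zero_im] at h3
    linarith

lemma IsHyperbolic.aeval_ne_zero_of_mem_cone (hhyp : IsHyperbolic h e lam) {M v : Fin m → ℝ}
    (hM : InCone lam M) (hv : InCone lam v) {δ : ℝ} (hδ : 0 < δ) {ε : ℝ} (hε : 0 < ε)
    (x : Fin m → ℝ) (w : ℂ) (hw : 0 ≤ w.im) :
    aeval (complexify x + (Complex.I * ε) • complexify (M + δ • e)
      + w • complexify (v + δ • e)) h ≠ 0 := by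
  have := hhyp.aeval_ne_zero_of_imaginary_part (y := ε • M) hv hδ (mul_pos hε hδ)
    (fun τ hτ x => by
      rw [smul_smul]
      exact hhyp.aeval_ne_zero_of_imaginary_part_mem_cone hM (mul_pos hε hδ)
        (mul_nonneg hτ hε.le) x) x w hw
  convert this using 2
  congr 2
  ext i
  simp [complexify]
  ring

lemma im_derivative_mul_conj_nonpos (p : Polynomial ℂ)
    (hp : ∀ w : ℂ, 0 ≤ w.im → p.eval w ≠ 0) :
    (p.derivative.eval 0 * (starRingEnd ℂ) (p.eval 0)).im ≤ 0 := by
  have h0 : p.eval 0 ≠ 0 := hp 0 (by simp)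
  have hp0 : p ≠ 0 := by
    rintro rfl
    simp at h0
  have key := (IsAlgClosed.splits p).eval_derivative_div_eval_of_ne_zero h0
  have him : ((p.roots.map fun z ↦ 1 / (0 - z)).sum).im ≤ 0 := by
    have hroots : ∀ r ∈ p.roots, r.im < 0 := fun r hr => by
      by_contra! hr'
      exact hp r hr' (Polynomial.mem_roots'.mp hr).2
    generalize p.roots = R at hroots
    induction R using Multiset.induction_on with
    | empty => simp
    | cons r R ih =>
      have h1 := ih fun r' hr' => hroots r' (by simp [hr'])
      have h2 : (1 / (0 - r)).im ≤ 0 := by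
        rw [zero_sub, one_div, Complex.inv_im, Complex.neg_im, neg_neg]
        exact div_nonpos_of_nonpos_of_nonneg (hroots r (by simp)).le (Complex.normSq_nonneg _)
      rw [Multiset.map_cons, Multiset.sum_cons, Complex.add_im]
      linarith
  have h3 : p.derivative.eval 0 * (starRingEnd ℂ) (p.eval 0)
      = ((Complex.normSq (p.eval 0) : ℝ) : ℂ) * (p.derivative.eval 0 / p.eval 0) := by
    rw [← Complex.mul_conj]
    field_simp
  rw [h3, Complex.im_ofReal_mul, key]
  exact mul_nonpos_of_nonneg_of_nonpos (Complex.normSq_nonneg _) him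

lemma derivative_mul_sub_nonpos_of_im_nonpos (A B : Polynomial ℝ)
    (hAB : ∀ ε : ℝ, 0 < ε →
      ((A.map (algebraMap ℝ ℂ)).eval (Complex.I * ε) *
        (starRingEnd ℂ) ((B.map (algebraMap ℝ ℂ)).eval (Complex.I * ε))).im ≤ 0) :
    A.derivative.eval 0 * B.eval 0 - A.eval 0 * B.derivative.eval 0 ≤ 0 := by
  set P := (A.map (algebraMap ℝ ℂ)).comp (Polynomial.C Complex.I * Polynomial.X) *
    (B.map (algebraMap ℝ ℂ)).comp (-(Polynomial.C Complex.I * Polynomial.X)) with hP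
  have hconj : ∀ ε : ℝ, (starRingEnd ℂ) ((B.map (algebraMap ℝ ℂ)).eval (Complex.I * ε))
      = (B.map (algebraMap ℝ ℂ)).eval (-(Complex.I * ε)) := fun ε => by
    rw [Polynomial.eval_map_algebraMap, Polynomial.eval_map_algebraMap,
      ← Polynomial.aeval_conj]
    simp
  have hPε : ∀ ε : ℝ, P.eval (ε : ℂ) = (A.map (algebraMap ℝ ℂ)).eval (Complex.I * ε) *
        (starRingEnd ℂ) ((B.map (algebraMap ℝ ℂ)).eval (Complex.I * ε)) := fun ε => by
    rw [hconj, hP]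
    simp [Polynomial.eval_comp]
  have hder : HasDerivAt (fun ε : ℝ => (P.eval (ε : ℂ)).im) (P.derivative.eval 0).im 0 := by
    have := (P.hasDerivAt ((0 : ℝ) : ℂ)).comp_ofReal
    have him : HasDerivAt (fun ε : ℝ => (P.eval (ε : ℂ)).im)
        (Complex.imCLM (P.derivative.eval ((0 : ℝ) : ℂ))) 0 :=
      Complex.imCLM.hasFDerivAt.comp_hasDerivAt (0 : ℝ) this
    simpa using him
  have hA0 : ∀ Q : Polynomial ℝ, (Q.map (algebraMap ℝ ℂ)).eval 0 = ((Q.eval 0 : ℝ) : ℂ) :=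
    fun Q => by
      have := Polynomial.eval_map_apply (p := Q) (f := algebraMap ℝ ℂ) (0 : ℝ)
      simpa using this
  have hval : (P.derivative.eval 0).im
      = A.derivative.eval 0 * B.eval 0 - A.eval 0 * B.derivative.eval 0 := by
    rw [hP]
    simp only [Polynomial.derivative_mul, Polynomial.derivative_comp, Polynomial.eval_add,
      Polynomial.eval_mul, Polynomial.eval_comp, Polynomial.derivative_map, Polynomial.eval_neg,
      Polynomial.eval_C, Polynomial.eval_X, mul_zero, neg_zero, hA0, Polynomial.derivative_neg,
      Polynomial.derivative_C, Polynomial.derivative_X, zero_mul, zero_add, mul_one]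
    simp
    ring
  rw [← hval]
  have hzero : (P.eval ((0 : ℝ) : ℂ)).im = 0 := by
    rw [hPε]
    simp [hA0]
  have hs := hder.hasDerivWithinAt (s := Set.Ioi 0)
  rw [hasDerivWithinAt_iff_tendsto_slope' (by simp)] at hs
  refine le_of_tendsto hs ?_
  filter_upwards [self_mem_nhdsWithin] with ε hε
  have hε : 0 < ε := hε
  rw [slope_def_field, hzero, sub_zero, sub_zero, hPε]
  exact div_nonpos_of_nonpos_of_nonneg (hAB ε hε) hε.le

lemma eval_Dv (f : MvPolynomial (Fin m) ℝ) (v x : Fin m → ℝ) :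
    eval x (Dv f v) = ∑ i, v i * eval x (pderiv i f) := by
  simp [Dv]

lemma derivative_linePoly_real (f : MvPolynomial (Fin m) ℝ) (x v : Fin m → ℝ) :
    (linePoly f x v).derivative = linePoly (Dv f v) x v :=
  linePoly_Dv f x v

lemma eval_linePoly_real (f : MvPolynomial (Fin m) ℝ) (x v : Fin m → ℝ) (t : ℝ) :
    (linePoly f x v).eval t = eval (x + t • v) f :=
  eval_linePoly f x v t

lemma IsHyperbolic.rayleigh_of_pos (hhyp : IsHyperbolic h e lam) {M v : Fin m → ℝ}
    (hM : InCone lam M) (hv : InCone lam v) {δ : ℝ} (hδ : 0 < δ) (x : Fin m → ℝ) :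
    eval x (Dv (Dv h (v + δ • e)) (M + δ • e)) * eval x h
      - eval x (Dv h (v + δ • e)) * eval x (Dv h (M + δ • e)) ≤ 0 := by
  have := derivative_mul_sub_nonpos_of_im_nonpos
    (linePoly (Dv h (v + δ • e)) x (M + δ • e)) (linePoly h x (M + δ • e)) fun ε hε => ?_
  · simpa [derivative_linePoly_real, eval_linePoly_real] using this
  · have key := im_derivative_mul_conj_nonpos
      (linePoly h (complexify x + (Complex.I * ε) • complexify (M + δ • e))
        (complexify (v + δ • e)))
      fun w hw => by
        rw [eval_linePoly]
        exact hhyp.aeval_ne_zero_of_mem_cone hM hv hδ hε x w hw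
    have hd := linePoly_Dv h (complexify x + (Complex.I * ε) • complexify (M + δ • e))
      (v + δ • e)
    change (linePoly h _ (complexify (v + δ • e))).derivative
      = linePoly _ _ (complexify (v + δ • e)) at hd
    rw [hd, eval_linePoly, eval_linePoly, zero_smul, add_zero] at key
    rwa [map_linePoly, map_linePoly, eval_linePoly, eval_linePoly]

/-- The strong Rayleigh inequality for cone directions of a hyperbolic polynomial. -/
lemma IsHyperbolic.rayleigh (hhyp : IsHyperbolic h e lam) {M v : Fin m → ℝ}
    (hM : InCone lam M) (hv : InCone lam v) (x : Fin m → ℝ) :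
    eval x (Dv (Dv h v) M) * eval x h ≤ eval x (Dv h v) * eval x (Dv h M) := by
  have hc : Continuous fun δ : ℝ => eval x (Dv (Dv h (v + δ • e)) (M + δ • e)) * eval x h
      - eval x (Dv h (v + δ • e)) * eval x (Dv h (M + δ • e)) := by
    have hD : ∀ v : Fin m → ℝ, ∀ i, pderiv i (Dv h v) = ∑ j, C (v j) * pderiv i (pderiv j h) :=
      fun v i => by simp [Dv, Derivation.leibniz]
    simp only [eval_Dv, hD, map_sum, map_mul, eval_C, Pi.add_apply, Pi.smul_apply]
    fun_prop
  have ht := (hc.tendsto 0).mono_left (nhdsWithin_le_nhds (s := Set.Ioi 0))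
  have := le_of_tendsto ht (by
    filter_upwards [self_mem_nhdsWithin] with δ hδ
    exact hhyp.rayleigh_of_pos hM hv hδ x)
  simpa using this

lemma IsHyperbolic.eval_smul_add_pos (hhyp : IsHyperbolic h e lam) {M : Fin m → ℝ}
    (hM : InCone lam M) {α t : ℝ} (hα : 0 < α) (ht : 0 ≤ t) : 0 < eval (α • e + t • M) h := by
  have hh : ∀ (c : ℝ) x, eval (c • x) h = c ^ d * eval x h :=
    fun c x => aeval_smul_of_isHomogeneous hhyp.1 c x
  have he := hhyp.2.1
  rcases ht.eq_or_lt with rfl | ht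
  · rw [zero_smul, add_zero, hh]
    positivity
  · have h1 : α • e + t • M = t • ((α / t) • e + M) := by
      rw [smul_add, smul_smul, mul_div_cancel₀ _ ht.ne']
    have h2 := hhyp.aeval_smul_add ((α / t : ℝ) : ℂ) M
    rw [← complexify_smul, ← complexify_add, aeval_complexify] at h2
    have h3 : eval ((α / t) • e + M) h = eval e h * ∏ i, (α / t + lam M i) := by
      exact_mod_cast h2
    rw [h1, hh, h3]
    have : 0 < ∏ i, (α / t + lam M i) := Finset.prod_pos fun i _ => by
      have := hM i
      positivity
    positivity

end Hyperbolic

/-- Monotonicity of the barrier ratio under adding a cone vector. -/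
theorem directional_ratio_monotone
    {m d : ℕ} (h : MvPolynomial (Fin m) ℝ) (e : Fin m → ℝ)
    (lam : (Fin m → ℝ) → Fin d → ℝ)
    (hhyp : IsHyperbolic h e lam) (he : InOpenCone lam e)
    (α : ℝ) (hα : 0 < α)
    (M v : Fin m → ℝ) (hM : InCone lam M) (hv : InCone lam v)
    (hDv : Dv h v ≠ 0) :
    eval (α • e + M) (Dv h v) / eval (α • e + M) h
      ≤ eval (α • e) (Dv h v) / eval (α • e) h := by
  have hder : ∀ (f : MvPolynomial (Fin m) ℝ) (t : ℝ),
      HasDerivAt (fun t : ℝ => eval (α • e + t • M) f) (eval (α • e + t • M) (Dv f M)) t := by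
    intro f t
    simpa only [derivative_linePoly_real, eval_linePoly_real] using
      (linePoly f (α • e) M).hasDerivAt t
  have hpos : ∀ t : ℝ, 0 ≤ t → 0 < eval (α • e + t • M) h :=
    fun t ht => hhyp.eval_smul_add_pos hM hα ht
  have hquot : ∀ t : ℝ, 0 ≤ t → HasDerivAt
      (fun t : ℝ => eval (α • e + t • M) (Dv h v) / eval (α • e + t • M) h) _ t :=
    fun t ht => (hder (Dv h v) t).div (hder h t) (hpos t ht).ne'
  have hanti : AntitoneOn
      (fun t : ℝ => eval (α • e + t • M) (Dv h v) / eval (α • e + t • M) h) (Set.Icc 0 1) := by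
    refine antitoneOn_of_deriv_nonpos (convex_Icc 0 1)
      (fun t ht => (hquot t ht.1).continuousAt.continuousWithinAt)
      (fun t ht => ?_) (fun t ht => ?_)
    · rw [interior_Icc] at ht
      exact (hquot t ht.1.le).differentiableAt.differentiableWithinAt
    · rw [interior_Icc] at ht
      rw [(hquot t ht.1.le).deriv]
      exact div_nonpos_of_nonpos_of_nonneg
        (sub_nonpos.mpr (hhyp.rayleigh hM hv _)) (sq_nonneg _)
  simpa using hanti (Set.left_mem_Icc.mpr zero_le_one) (Set.right_mem_Icc.mpr zero_le_one)
    zero_le_one
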